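/- arXiv:1502.01405 — 2 statements merged into one kernel-verified Lean document; each statement's English description precedes it below -/
import Mathlib

section
/- Let T and T' be triangulations of a convex (n+2)-gon both containing a common interior diagonal f. Then every geodesic from T to T' in the flip graph (vertices: triangulations; edges: pairs of triangulations differing by one flip) passes only through triangulations containing f. -/
open scoped Classical

/-- `d = (a,b)` is an interior diagonal of the convex polygon with vertices
`0, 1, …, n+1`: `a < b`, and `a, b` are not adjacent on the boundary cycle. -/
def IsDiag (n : ℕ) (d : Fin (n + 2) × Fin (n + 2)) : Prop :=
  d.1 < d.2 ∧ (d.1 : ℕ) + 1 < (d.2 : ℕ) ∧ ¬((d.1 : ℕ) = 0 ∧ (d.2 : ℕ) = n + 1)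

/-- Two diagonals `(a,b)` and `(a₀,b₀)` (with `a < b`, `a₀ < b₀`) cross iff
`a < a₀ < b < b₀` or `a₀ < a < b₀ < b`. -/
def Crossing {n : ℕ} (d e : Fin (n + 2) × Fin (n + 2)) : Prop :=
  (d.1 < e.1 ∧ e.1 < d.2 ∧ d.2 < e.2) ∨ (e.1 < d.1 ∧ d.1 < e.2 ∧ e.2 < d.2)

/-- A triangulation of the convex `(n+2)`-gon: a maximal set of pairwise noncrossing
interior diagonals. -/
def IsTriangulation (n : ℕ) (T : Finset (Fin (n + 2) × Fin (n + 2))) : Prop :=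
  (∀ d ∈ T, IsDiag n d) ∧ (∀ d ∈ T, ∀ e ∈ T, ¬Crossing d e) ∧
  (∀ e, IsDiag n e → (∀ d ∈ T, ¬Crossing d e) → e ∈ T)

/-- The flip graph: vertices are the triangulations of the convex `(n+2)`-gon, with an
edge between two triangulations differing in exactly one diagonal. -/
def flipGraph (n : ℕ) :
    SimpleGraph {T : Finset (Fin (n + 2) × Fin (n + 2)) // IsTriangulation n T} :=
  SimpleGraph.fromRel (fun T T' => (T.1 \ T'.1).card = 1 ∧ (T'.1 \ T.1).card = 1)

structure Sat (n : ℕ) (S : Finset (Fin (n + 2) × Fin (n + 2))) : Prop where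
  len : ∀ u v, (u, v) ∈ S → (u : ℕ) + 1 < (v : ℕ)
  nc : ∀ u v x y, (u, v) ∈ S → (x, y) ∈ S → (u : ℕ) < x → (x : ℕ) < v → (v : ℕ) < y → False
  mx : ∀ u v : Fin (n + 2), (u : ℕ) + 1 < (v : ℕ) → (u, v) ∉ S →
    ∃ x y, (x, y) ∈ S ∧ (((x : ℕ) < u ∧ (u : ℕ) < y ∧ (y : ℕ) < v) ∨
      ((u : ℕ) < x ∧ (x : ℕ) < v ∧ (v : ℕ) < y))

theorem Sat.tri {n : ℕ} {S : Finset (Fin (n + 2) × Fin (n + 2))} (h : Sat n S)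
    (u v : Fin (n + 2)) (huv : (u, v) ∈ S) :
    ∃ w : Fin (n + 2), (u : ℕ) < w ∧ (w : ℕ) < v ∧ ((u : ℕ) + 1 = w ∨ (u, w) ∈ S) ∧
      ((w : ℕ) + 1 = v ∨ (w, v) ∈ S) := by
  have hl := h.len u v huv
  obtain ⟨w, hw, hmax⟩ := Finset.exists_max_image
    (Finset.univ.filter (fun w : Fin (n + 2) => (u : ℕ) < w ∧ (w : ℕ) < v ∧
      ((u : ℕ) + 1 = w ∨ (u, w) ∈ S))) (fun w => (w : ℕ))
    ⟨⟨u + 1, by omega⟩, Finset.mem_filter.2 ⟨Finset.mem_univ _, by show (u : ℕ) < u + 1; omega, hl, Or.inl rfl⟩⟩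
  simp only [Finset.mem_filter, Finset.mem_univ, true_and] at hw hmax
  obtain ⟨h1, h2, h3⟩ := hw
  refine ⟨w, h1, h2, h3, ?_⟩
  by_contra hcon
  push Not at hcon
  obtain ⟨x, y, hxy, hc⟩ := h.mx w v (by omega) hcon.2
  rcases hc with ⟨a1, a2, a3⟩ | ⟨a1, a2, a3⟩
  · rcases lt_trichotomy (x : ℕ) u with hx | hx | hx
    · exact h.nc x y u v hxy huv hx (by omega) a3
    · have : x = u := Fin.ext hx
      subst this
      have := hmax y ⟨by omega, a3, Or.inr hxy⟩
      omega
    · rcases h3 with h3 | h3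
      · omega
      · exact h.nc u w x y h3 hxy hx a1 a2
  · exact h.nc u v x y huv hxy (by omega) a2 a3

theorem Sat.card_within {n : ℕ} {S : Finset (Fin (n + 2) × Fin (n + 2))} (h : Sat n S) (k : ℕ) :
    ∀ u v : Fin (n + 2), (v : ℕ) = u + k + 1 → ((u : ℕ) + 1 = v ∨ (u, v) ∈ S) →
      (S.filter (fun d => (u : ℕ) ≤ d.1 ∧ (d.2 : ℕ) ≤ v)).card = k := by
  induction k using Nat.strong_induction_on with
  | _ k ih =>
    intro u v hk huv
    by_cases h1 : (u : ℕ) + 1 = v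
    · have : k = 0 := by omega
      subst this
      rw [Finset.card_eq_zero, Finset.filter_eq_empty_iff]
      rintro ⟨x, y⟩ hxy
      have := h.len x y hxy
      simp only
      omega
    · have huv : (u, v) ∈ S := by tauto
      obtain ⟨w, w1, w2, w3, w4⟩ := h.tri u v huv
      have e1 := ih ((w : ℕ) - u - 1) (by omega) u w (by omega) w3
      have e2 := ih ((v : ℕ) - w - 1) (by omega) w v (by omega) w4
      have key : S.filter (fun d => (u : ℕ) ≤ d.1 ∧ (d.2 : ℕ) ≤ v) =
          insert (u, v) (S.filter (fun d => (u : ℕ) ≤ d.1 ∧ (d.2 : ℕ) ≤ w) ∪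
            S.filter (fun d => (w : ℕ) ≤ d.1 ∧ (d.2 : ℕ) ≤ v)) := by
        ext ⟨x, y⟩
        simp only [Finset.mem_filter, Finset.mem_insert, Finset.mem_union, Prod.mk.injEq]
        constructor
        · rintro ⟨hxy, hx, hy⟩
          have hl := h.len x y hxy
          by_cases c1 : (y : ℕ) ≤ w
          · exact Or.inr (Or.inl ⟨hxy, hx, c1⟩)
          by_cases c2 : (w : ℕ) ≤ x
          · exact Or.inr (Or.inr ⟨hxy, c2, hy⟩)
          left
          constructor
          · by_contra hne
            have hne : (x : ℕ) ≠ u := fun hh => hne (Fin.ext hh)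
            rcases w3 with w3 | w3
            · omega
            · exact h.nc u w x y w3 hxy (by omega) (by omega) (by omega)
          · by_contra hne
            have hne : (y : ℕ) ≠ v := fun hh => hne (Fin.ext hh)
            rcases w4 with w4 | w4
            · omega
            · exact h.nc x y w v hxy w4 (by omega) (by omega) (by omega)
        · rintro (⟨rfl, rfl⟩ | ⟨a, b, c⟩ | ⟨a, b, c⟩)
          · exact ⟨huv, le_refl _, le_refl _⟩
          · exact ⟨a, b, by omega⟩
          · exact ⟨a, by omega, c⟩
      rw [key, Finset.card_insert_of_notMem, Finset.card_union_of_disjoint, e1, e2]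
      · omega
      · rw [Finset.disjoint_left]
        rintro ⟨x, y⟩ hx hy
        simp only [Finset.mem_filter] at hx hy
        have := h.len x y hx.1
        omega
      · simp only [Finset.mem_union, Finset.mem_filter]
        omega

theorem tri_sat {n : ℕ} (hn : 3 ≤ n) {T : Finset (Fin (n + 2) × Fin (n + 2))}
    (h : IsTriangulation n T) : Sat n (insert (0, Fin.last (n + 1)) T) := by
  obtain ⟨h1, h2, h3⟩ := h
  refine ⟨?_, ?_, ?_⟩
  · intro u v huv
    rw [Finset.mem_insert] at huv
    rcases huv with huv | huv
    · rw [Prod.mk.injEq] at huv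
      rw [huv.1, huv.2]
      simp; omega
    · exact (h1 _ huv).2.1
  · intro u v x y huv hxy a b c
    rw [Finset.mem_insert] at huv hxy
    rcases huv with huv | huv
    · rw [Prod.mk.injEq] at huv
      rw [huv.2] at c
      simp at c
      omega
    rcases hxy with hxy | hxy
    · rw [Prod.mk.injEq] at hxy
      rw [hxy.1] at a
      simp at a
    · exact h2 _ huv _ hxy (Or.inl ⟨a, b, c⟩)
  · intro u v huv hn'
    rw [Finset.mem_insert, not_or] at hn'
    by_contra hcon
    refine hn'.2 (h3 (u, v) ⟨?_, huv, ?_⟩ ?_)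
    · show (u : ℕ) < v
      omega
    · rintro ⟨a, b⟩
      apply hn'.1
      rw [Prod.mk.injEq]
      exact ⟨Fin.ext (by simpa using a), Fin.ext (by simpa using b)⟩
    · rintro ⟨x, y⟩ hd hc
      exact hcon ⟨x, y, Finset.mem_insert_of_mem hd, hc⟩

theorem tri_card {n : ℕ} (hn : 3 ≤ n) {T : Finset (Fin (n + 2) × Fin (n + 2))}
    (h : IsTriangulation n T) : T.card + 1 = n := by
  have hs := tri_sat hn h
  have := hs.card_within n 0 (Fin.last (n + 1)) (by simp) (Or.inr (Finset.mem_insert_self _ _))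
  rw [Finset.filter_true_of_mem, Finset.card_insert_of_notMem] at this
  · exact this
  · intro hm
    have := (h.1 _ hm).2.2
    simp at this
  · rintro ⟨x, y⟩ _
    simp
    omega

/-- The retraction onto the triangulations containing `(0, b)`. -/
noncomputable def retr {n : ℕ} (b : Fin (n + 2)) (T : Finset (Fin (n + 2) × Fin (n + 2))) :
    Finset (Fin (n + 2) × Fin (n + 2)) :=
  Finset.univ.filter (fun e =>
    (e ∈ T ∧ ¬ ((0 : ℕ) < e.1 ∧ (e.1 : ℕ) < b ∧ (b : ℕ) < e.2)) ∨ e = (0, b) ∨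
    (IsDiag n e ∧ (e.1 : ℕ) = 0 ∧
      ∃ d ∈ T, ((0 : ℕ) < d.1 ∧ (d.1 : ℕ) < b ∧ (b : ℕ) < d.2) ∧ (e.2 = d.1 ∨ e.2 = d.2)))

theorem mem_retr {n : ℕ} {b : Fin (n + 2)} {T : Finset (Fin (n + 2) × Fin (n + 2))}
    {u v : Fin (n + 2)} : (u, v) ∈ retr b T ↔
    ((u, v) ∈ T ∧ ¬ ((0 : ℕ) < u ∧ (u : ℕ) < b ∧ (b : ℕ) < v)) ∨ (u = 0 ∧ v = b) ∨
    (IsDiag n (u, v) ∧ (u : ℕ) = 0 ∧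
      ∃ x y, (x, y) ∈ T ∧ ((0 : ℕ) < x ∧ (x : ℕ) < b ∧ (b : ℕ) < y) ∧ (v = x ∨ v = y)) := by
  simp [retr]

theorem isDiag_iff {n : ℕ} {u v : Fin (n + 2)} : IsDiag n (u, v) ↔
    ((u : ℕ) + 1 < v ∧ ¬ ((u : ℕ) = 0 ∧ (v : ℕ) = n + 1)) := by
  simp only [IsDiag, Fin.lt_def]
  constructor
  · exact fun h => h.2
  · exact fun h => ⟨by omega, h⟩

theorem tri_nc {n : ℕ} {T : Finset (Fin (n + 2) × Fin (n + 2))}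
    (h : IsTriangulation n T) {u v x y : Fin (n + 2)} (h1 : (u, v) ∈ T) (h2 : (x, y) ∈ T)
    (a : (u : ℕ) < x) (b : (x : ℕ) < v) (c : (v : ℕ) < y) : False :=
  h.2.1 _ h1 _ h2 (Or.inl ⟨a, b, c⟩)

theorem retr_tri {n : ℕ} (hn : 3 ≤ n) {b : Fin (n + 2)} (hb : IsDiag n (0, b))
    {T : Finset (Fin (n + 2) × Fin (n + 2))} (h : IsTriangulation n T) :
    IsTriangulation n (retr b T) := by
  have hb' := isDiag_iff.1 hb
  have hb0 : ((0 : Fin (n + 2)) : ℕ) = 0 := rfl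
  -- half of noncrossing
  have hnc : ∀ u v x y, (u, v) ∈ retr b T → (x, y) ∈ retr b T → (u : ℕ) < x → (x : ℕ) < v →
      (v : ℕ) < y → False := by
    intro u v x y h1 h2 a1 a2 a3
    rw [mem_retr] at h1 h2
    have h2' : (x, y) ∈ T ∧ ¬ ((0 : ℕ) < x ∧ (x : ℕ) < b ∧ (b : ℕ) < y) := by
      rcases h2 with h2 | ⟨rfl, _⟩ | ⟨_, h2, _⟩
      · exact h2
      · omega
      · omega
    rcases h1 with h1 | ⟨rfl, rfl⟩ | ⟨_, h1, p, q, hpq, hp, h3⟩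
    · exact tri_nc h h1.1 h2'.1 a1 a2 a3
    · exact h2'.2 ⟨by omega, a2, a3⟩
    · rcases h3 with rfl | rfl
      · by_cases c : (q : ℕ) ≤ y
        · exact h2'.2 (by omega)
        · exact tri_nc h h2'.1 hpq a2 a3 (by omega)
      · by_cases c : (x : ℕ) ≤ p
        · exact h2'.2 (by omega)
        · exact tri_nc h hpq h2'.1 (by omega) a2 a3
  refine ⟨?_, ?_, ?_⟩
  · rintro ⟨u, v⟩ hm
    rw [mem_retr] at hm
    rcases hm with hm | ⟨rfl, rfl⟩ | hm
    · exact h.1 _ hm.1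
    · exact hb
    · exact hm.1
  · rintro ⟨u, v⟩ h1 ⟨x, y⟩ h2 (hc | hc)
    · exact hnc u v x y h1 h2 hc.1 hc.2.1 hc.2.2
    · exact hnc x y u v h2 h1 hc.1 hc.2.1 hc.2.2
  · rintro ⟨u, v⟩ hd hc
    have hc1 : ∀ x y, (x, y) ∈ retr b T → (x : ℕ) < u → (u : ℕ) < y → (y : ℕ) < v → False :=
      fun x y hx a1 a2 a3 => hc _ hx (Or.inl ⟨a1, a2, a3⟩)
    have hc2 : ∀ x y, (x, y) ∈ retr b T → (u : ℕ) < x → (x : ℕ) < v → (v : ℕ) < y → False :=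
      fun x y hx a1 a2 a3 => hc _ hx (Or.inr ⟨a1, a2, a3⟩)
    clear hc
    have hd' := isDiag_iff.1 hd
    have hf : ((0 : Fin (n + 2)), b) ∈ retr b T := mem_retr.2 (Or.inr (Or.inl ⟨rfl, rfl⟩))
    have hvn := v.2
    by_cases hT : (u, v) ∈ T
    · refine mem_retr.2 (Or.inl ⟨hT, fun hh => ?_⟩)
      exact hc1 _ _ hf hh.1 hh.2.1 hh.2.2
    have : ∃ x y, (x, y) ∈ T ∧ (((x : ℕ) < u ∧ (u : ℕ) < y ∧ (y : ℕ) < v) ∨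
      ((u : ℕ) < x ∧ (x : ℕ) < v ∧ (v : ℕ) < y)) := by
      by_contra hcon
      exact hT (h.2.2 _ hd fun ⟨x, y⟩ hx hcr => hcon ⟨x, y, hx, hcr⟩)
    obtain ⟨x, y, hxy, hcr⟩ := this
    have hx : (0 : ℕ) < x ∧ (x : ℕ) < b ∧ (b : ℕ) < y := by
      by_contra hx
      have := mem_retr.2 (Or.inl ⟨hxy, hx⟩)
      rcases hcr with hcr | hcr
      · exact hc1 _ _ this hcr.1 hcr.2.1 hcr.2.2
      · exact hc2 _ _ this hcr.1 hcr.2.1 hcr.2.2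
    by_cases hu : (0 : ℕ) < u
    · exfalso
      rcases hcr with hcr | hcr
      · refine hc1 0 y (mem_retr.2 (Or.inr (Or.inr ⟨isDiag_iff.2 ⟨by omega, by omega⟩, rfl,
          x, y, hxy, hx, Or.inr rfl⟩))) hu hcr.2.1 hcr.2.2
      · refine hc1 0 x (mem_retr.2 (Or.inr (Or.inr ⟨isDiag_iff.2 ⟨by omega, by omega⟩, rfl,
          x, y, hxy, hx, Or.inl rfl⟩))) hu hcr.1 hcr.2.1
    have hu0 : (u : ℕ) = 0 := by omega
    by_cases hvb : v = b
    · exact mem_retr.2 (Or.inr (Or.inl ⟨Fin.ext hu0, hvb⟩))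
    have hvb' : (v : ℕ) ≠ b := fun hh => hvb (Fin.ext hh)
    obtain ⟨⟨p, q⟩, hpq, hmin⟩ := Finset.exists_min_image
      (T.filter (fun d => (0 : ℕ) < d.1 ∧ (d.1 : ℕ) < v ∧ (v : ℕ) < d.2))
      (fun d => (d.2 : ℕ) - d.1)
      ⟨(x, y), Finset.mem_filter.2 ⟨hxy, by simp only; omega⟩⟩
    rw [Finset.mem_filter] at hpq
    obtain ⟨hpq, p1, p2, p3⟩ := hpq
    simp only at p1 p2 p3
    have hs := tri_sat hn h
    have hS : ∀ s t : Fin (n + 2), (0 : ℕ) < s → (s, t) ∈ insert (0, Fin.last (n + 1)) T →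
        (s, t) ∈ T := by
      intro s t h0 hm
      rw [Finset.mem_insert] at hm
      rcases hm with hm | hm
      · rw [Prod.mk.injEq] at hm
        rw [hm.1] at h0
        omega
      · exact hm
    obtain ⟨w, w1, w2, w3, w4⟩ := hs.tri p q (Finset.mem_insert_of_mem hpq)
    have w3' : (p : ℕ) + 1 = w ∨ (p, w) ∈ T := w3.imp_right (hS _ _ p1)
    have w4' : (w : ℕ) + 1 = q ∨ (w, q) ∈ T := w4.imp_right (hS _ _ (by omega))
    have hwv : w = v := by
      apply Fin.ext
      by_contra hne
      rcases Nat.lt_or_gt_of_ne hne with hlt | hlt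
      · rcases w4' with w4' | w4'
        · omega
        · have := hmin (w, q) (Finset.mem_filter.2 ⟨w4', by simp only; omega⟩)
          simp only at this
          omega
      · rcases w3' with w3' | w3'
        · omega
        · have := hmin (p, w) (Finset.mem_filter.2 ⟨w3', by simp only; omega⟩)
          simp only at this
          omega
    subst hwv
    have hcr : (0 : ℕ) < p ∧ (p : ℕ) < b ∧ (b : ℕ) < q := by
      by_contra hh
      exact hc2 _ _ (mem_retr.2 (Or.inl ⟨hpq, hh⟩)) (by omega) p2 p3
    refine mem_retr.2 (Or.inr (Or.inr ⟨hd, hu0, ?_⟩))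
    rcases Nat.lt_or_gt_of_ne hvb' with hlt | hlt
    · rcases w4' with w4' | w4'
      · omega
      · exact ⟨w, q, w4', by omega, Or.inl rfl⟩
    · rcases w3' with w3' | w3'
      · omega
      · exact ⟨p, w, w3', by omega, Or.inr rfl⟩

theorem tri_eq_of_subset {n : ℕ} (hn : 3 ≤ n) {T T' : Finset (Fin (n + 2) × Fin (n + 2))}
    (h : IsTriangulation n T) (h' : IsTriangulation n T') (hs : T ⊆ T') : T = T' := by
  have := tri_card hn h
  have := tri_card hn h'
  exact Finset.eq_of_subset_of_card_le hs (by omega)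

theorem retr_self {n : ℕ} (hn : 3 ≤ n) {b : Fin (n + 2)} (hb : IsDiag n (0, b))
    {T : Finset (Fin (n + 2) × Fin (n + 2))} (h : IsTriangulation n T) (hm : (0, b) ∈ T) :
    retr b T = T := by
  symm
  apply tri_eq_of_subset hn h (retr_tri hn hb h)
  rintro ⟨u, v⟩ huv
  exact mem_retr.2 (Or.inl ⟨huv, fun hh => tri_nc h hm huv hh.1 hh.2.1 hh.2.2⟩)

/-- If `f ∈ T`, `T'` is a flip of `T` with `f ∉ T'`, then `T'` retracts to `T`. -/
theorem retr_flip {n : ℕ} (hn : 3 ≤ n) {b : Fin (n + 2)} (hb : IsDiag n (0, b))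
    {T T' : Finset (Fin (n + 2) × Fin (n + 2))} (h : IsTriangulation n T)
    (h' : IsTriangulation n T') (hm : (0, b) ∈ T) (hm' : (0, b) ∉ T')
    (hc : (T \ T').card = 1) : retr b T' = T := by
  symm
  apply tri_eq_of_subset hn h (retr_tri hn hb h')
  rintro ⟨u, v⟩ huv
  by_cases hT' : (u, v) ∈ T'
  · exact mem_retr.2 (Or.inl ⟨hT', fun hh => tri_nc h hm huv hh.1 hh.2.1 hh.2.2⟩)
  · obtain ⟨d, hd⟩ := Finset.card_eq_one.1 hc
    have e1 : ((0 : Fin (n + 2)), b) ∈ T \ T' := Finset.mem_sdiff.2 ⟨hm, hm'⟩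
    have e2 : (u, v) ∈ T \ T' := Finset.mem_sdiff.2 ⟨huv, hT'⟩
    rw [hd, Finset.mem_singleton] at e1 e2
    rw [e2, ← e1]
    exact mem_retr.2 (Or.inr (Or.inl ⟨rfl, rfl⟩))

theorem sdiff_card_comm {n : ℕ} (hn : 3 ≤ n) {T T' : Finset (Fin (n + 2) × Fin (n + 2))}
    (h : IsTriangulation n T) (h' : IsTriangulation n T') : (T \ T').card = (T' \ T).card := by
  have a := tri_card hn h
  have b := tri_card hn h'
  exact Finset.card_sdiff_comm (by omega)

theorem retr_adj {n : ℕ} (hn : 3 ≤ n) {b : Fin (n + 2)} (hb : IsDiag n (0, b))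
    {T T' : Finset (Fin (n + 2) × Fin (n + 2))} (h : IsTriangulation n T)
    (h' : IsTriangulation n T') (hc : (T \ T').card = 1) (hc' : (T' \ T).card = 1) :
    (retr b T \ retr b T').card ≤ 1 := by
  -- when the removed diagonal does not cross `f`
  have easy : ∀ T T' : Finset (Fin (n + 2) × Fin (n + 2)), ∀ d, T \ T' = {d} →
      ¬ ((0 : ℕ) < d.1 ∧ (d.1 : ℕ) < b ∧ (b : ℕ) < d.2) →
      (retr b T \ retr b T').card ≤ 1 := by
    intro T T' d hd hcr
    have hsub : ∀ e, e ∈ T → e ≠ d → e ∈ T' := by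
      intro e he hne
      by_contra hcon
      have : e ∈ T \ T' := Finset.mem_sdiff.2 ⟨he, hcon⟩
      rw [hd, Finset.mem_singleton] at this
      exact hne this
    rw [← Finset.card_singleton d]
    apply Finset.card_le_card
    rintro ⟨u, v⟩ hm
    rw [Finset.mem_sdiff] at hm
    rw [Finset.mem_singleton]
    by_contra hne
    apply hm.2
    rcases mem_retr.1 hm.1 with h1 | h1 | ⟨h1, h2, x, y, h3, h4, h5⟩
    · exact mem_retr.2 (Or.inl ⟨hsub _ h1.1 hne, h1.2⟩)
    · exact mem_retr.2 (Or.inr (Or.inl h1))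
    · refine mem_retr.2 (Or.inr (Or.inr ⟨h1, h2, x, y, hsub _ h3 ?_, h4, h5⟩))
      rintro rfl
      exact hcr h4
  obtain ⟨⟨p, q⟩, hd⟩ := Finset.card_eq_one.1 hc
  obtain ⟨⟨s, t⟩, hd'⟩ := Finset.card_eq_one.1 hc'
  by_cases c1 : ((0 : ℕ) < p ∧ (p : ℕ) < b ∧ (b : ℕ) < q)
  swap
  · exact easy T T' _ hd c1
  by_cases c2 : ((0 : ℕ) < s ∧ (s : ℕ) < b ∧ (b : ℕ) < t)
  swap
  · rw [sdiff_card_comm hn (retr_tri hn hb h) (retr_tri hn hb h')]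
    exact easy T' T _ hd' c2
  have hsub : ∀ e, e ∈ T → e ≠ (p, q) → e ∈ T' := by
    intro e he hne
    by_contra hcon
    have : e ∈ T \ T' := Finset.mem_sdiff.2 ⟨he, hcon⟩
    rw [hd, Finset.mem_singleton] at this
    exact hne this
  have hsub' : ∀ e, e ∈ T' → e ≠ (s, t) → e ∈ T := by
    intro e he hne
    by_contra hcon
    have : e ∈ T' \ T := Finset.mem_sdiff.2 ⟨he, hcon⟩
    rw [hd', Finset.mem_singleton] at this
    exact hne this
  have hpq : (p, q) ∈ T ∧ (p, q) ∉ T' := Finset.mem_sdiff.1 (by rw [hd]; simp)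
  have hst : (s, t) ∈ T' ∧ (s, t) ∉ T := Finset.mem_sdiff.1 (by rw [hd']; simp)
  -- the two diagonals cross
  have hcross : ((p : ℕ) < s ∧ (q : ℕ) < t) ∨ ((s : ℕ) < p ∧ (t : ℕ) < q) := by
    by_contra hcon
    apply hpq.2
    refine h'.2.2 _ (h.1 _ hpq.1) ?_
    rintro ⟨x, y⟩ hxy hcr
    by_cases he : (x, y) = (s, t)
    · rw [Prod.mk.injEq] at he
      obtain ⟨rfl, rfl⟩ := he
      simp only [Crossing, Fin.lt_def] at hcr
      omega
    · exact h.2.1 _ (hsub' _ hxy he) _ hpq.1 hcr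
  -- one endpoint of `(p, q)` survives
  have hsurv : ∃ x y, (x, y) ∈ T' ∧ ((0 : ℕ) < x ∧ (x : ℕ) < b ∧ (b : ℕ) < y) ∧ (x = p ∨ y = q) := by
    rcases hcross with hcr | hcr
    · refine ⟨p, t, h'.2.2 _ (isDiag_iff.2 (by omega)) ?_, by omega, Or.inl rfl⟩
      rintro ⟨x, y⟩ hxy hx
      by_cases he : (x, y) = (s, t)
      · rw [Prod.mk.injEq] at he
        obtain ⟨rfl, rfl⟩ := he
        simp only [Crossing, Fin.lt_def] at hx
        omega
      · have g1 := h.2.1 _ (hsub' _ hxy he) _ hpq.1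
        have g2 := h'.2.1 _ hxy _ hst.1
        simp only [Crossing, Fin.lt_def] at hx g1 g2
        omega
    · refine ⟨s, q, h'.2.2 _ (isDiag_iff.2 (by omega)) ?_, by omega, Or.inr rfl⟩
      rintro ⟨x, y⟩ hxy hx
      by_cases he : (x, y) = (s, t)
      · rw [Prod.mk.injEq] at he
        obtain ⟨rfl, rfl⟩ := he
        simp only [Crossing, Fin.lt_def] at hx
        omega
      · have g1 := h.2.1 _ (hsub' _ hxy he) _ hpq.1
        have g2 := h'.2.1 _ hxy _ hst.1
        simp only [Crossing, Fin.lt_def] at hx g1 g2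
        omega
  obtain ⟨x, y, hxy, hcr, hor⟩ := hsurv
  have main : ∀ u v, (u, v) ∈ retr b T \ retr b T' →
      u = 0 ∧ ((v = p ∧ x ≠ p) ∨ (v = q ∧ y ≠ q)) := by
    intro u v hm
    rw [Finset.mem_sdiff] at hm
    rcases mem_retr.1 hm.1 with h1 | h1 | ⟨h1, h2, x', y', h3, h4, h5⟩
    · exfalso
      refine hm.2 (mem_retr.2 (Or.inl ⟨hsub _ h1.1 ?_, h1.2⟩))
      intro he
      rw [Prod.mk.injEq] at he
      obtain ⟨rfl, rfl⟩ := he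
      exact h1.2 c1
    · exact absurd (mem_retr.2 (Or.inr (Or.inl h1))) hm.2
    · refine ⟨Fin.ext h2, ?_⟩
      by_cases he : (x', y') = (p, q)
      · rw [Prod.mk.injEq] at he
        obtain ⟨rfl, rfl⟩ := he
        rcases h5 with rfl | rfl
        · left
          refine ⟨rfl, ?_⟩
          rintro rfl
          exact hm.2 (mem_retr.2 (Or.inr (Or.inr ⟨h1, h2, _, _, hxy, hcr, Or.inl rfl⟩)))
        · right
          refine ⟨rfl, ?_⟩
          rintro rfl
          exact hm.2 (mem_retr.2 (Or.inr (Or.inr ⟨h1, h2, _, _, hxy, hcr, Or.inr rfl⟩)))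
      · exact absurd (mem_retr.2 (Or.inr (Or.inr ⟨h1, h2, x', y', hsub _ h3 he, h4, h5⟩))) hm.2
  rw [Finset.card_le_one]
  rintro ⟨u, v⟩ hu ⟨u', v'⟩ hu'
  have m1 := main u v hu
  have m2 := main u' v' hu'
  rw [Prod.mk.injEq]
  refine ⟨m1.1.trans m2.1.symm, ?_⟩
  rcases hor with hor | hor
  · rcases m1.2 with m | m
    · exact absurd hor m.2
    · rcases m2.2 with m' | m'
      · exact absurd hor m'.2
      · exact m.1.trans m'.1.symm
  · rcases m1.2 with m | m
    · rcases m2.2 with m' | m'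
      · exact m.1.trans m'.1.symm
      · exact absurd hor m'.2
    · exact absurd hor m.2

theorem flip_adj {n : ℕ} {T T' : {T : Finset (Fin (n + 2) × Fin (n + 2)) // IsTriangulation n T}} :
    (flipGraph n).Adj T T' ↔ ((T.1 \ T'.1).card = 1 ∧ (T'.1 \ T.1).card = 1) := by
  simp only [flipGraph, SimpleGraph.fromRel_adj]
  constructor
  · rintro ⟨_, h | h⟩
    · exact h
    · exact ⟨h.2, h.1⟩
  · intro h
    refine ⟨?_, Or.inl h⟩
    rintro rfl
    simp at h

theorem walk_retr {n : ℕ} (hn : 3 ≤ n) {b : Fin (n + 2)} (hb : IsDiag n (0, b))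
    {T T' : {T : Finset (Fin (n + 2) × Fin (n + 2)) // IsTriangulation n T}}
    (p : (flipGraph n).Walk T T') :
    ∃ q : (flipGraph n).Walk ⟨retr b T.1, retr_tri hn hb T.2⟩ ⟨retr b T'.1, retr_tri hn hb T'.2⟩,
      q.length ≤ p.length ∧
      ((0, b) ∈ T.1 → (∃ X ∈ p.support, (0, b) ∉ X.1) → q.length < p.length) := by
  induction p with
  | nil =>
    refine ⟨SimpleGraph.Walk.nil, le_refl _, ?_⟩
    rintro h ⟨X, hX, hX'⟩
    simp at hX
    rw [hX] at hX'
    exact absurd h hX'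
  | @cons T S T' hadj p ih =>
    obtain ⟨q, hq1, hq2⟩ := ih
    have ha := flip_adj.1 hadj
    by_cases heq : retr b T.1 = retr b S.1
    · refine ⟨q.copy (Subtype.ext heq.symm) rfl, ?_, ?_⟩
      · simp; omega
      · intro _ _
        simp; omega
    · have h1 := retr_adj hn hb T.2 S.2 ha.1 ha.2
      have h2 := sdiff_card_comm hn (retr_tri hn hb T.2) (retr_tri hn hb S.2)
      have h3 : (retr b T.1 \ retr b S.1).card ≠ 0 := by
        intro h0
        rw [Finset.card_eq_zero, Finset.sdiff_eq_empty_iff_subset] at h0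
        exact heq (tri_eq_of_subset hn (retr_tri hn hb T.2) (retr_tri hn hb S.2) h0)
      have hA : (flipGraph n).Adj ⟨retr b T.1, retr_tri hn hb T.2⟩
          ⟨retr b S.1, retr_tri hn hb S.2⟩ := flip_adj.2 ⟨by simp only; omega, by simp only; omega⟩
      refine ⟨SimpleGraph.Walk.cons hA q, ?_, ?_⟩
      · simp; omega
      · rintro hT ⟨X, hX, hX'⟩
        have hS : (0, b) ∈ S.1 := by
          by_contra hS
          apply heq
          rw [retr_flip hn hb T.2 S.2 hT hS ha.1, retr_self hn hb T.2 hT]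
        rw [SimpleGraph.Walk.support_cons, List.mem_cons] at hX
        have := hq2 hS ⟨X, hX.resolve_left (by rintro rfl; exact hX' hT), hX'⟩
        simp; omega

theorem keeps_zero {n : ℕ} (hn : 3 ≤ n) (b : Fin (n + 2)) (hb : IsDiag n (0, b))
    (T T' : {T : Finset (Fin (n + 2) × Fin (n + 2)) // IsTriangulation n T})
    (hfT : (0, b) ∈ T.1) (hfT' : (0, b) ∈ T'.1)
    (p : (flipGraph n).Walk T T') (hp : p.length = (flipGraph n).dist T T') :
    ∀ X ∈ p.support, (0, b) ∈ X.1 := by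
  by_contra hcon
  push Not at hcon
  obtain ⟨q, _, hq⟩ := walk_retr hn hb p
  have h1 := hq hfT hcon
  have h2 := SimpleGraph.dist_le (q.copy (Subtype.ext (retr_self hn hb T.2 hfT))
    (Subtype.ext (retr_self hn hb T'.2 hfT')))
  simp at h2
  omega

/-- Rank of a vertex after rotating `a` to `0`. -/
def rk {n : ℕ} (a x : Fin (n + 2)) : Fin (n + 2) :=
  if h : (a : ℕ) ≤ x then ⟨x - a, by omega⟩ else ⟨x + (n + 2) - a, by omega⟩

theorem rk_val {n : ℕ} (a x : Fin (n + 2)) :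
    (rk a x : ℕ) = if (a : ℕ) ≤ x then (x : ℕ) - a else x + (n + 2) - a := by
  unfold rk
  split_ifs <;> rfl

/-- Rotation on pairs. -/
def rot {n : ℕ} (a : Fin (n + 2)) (d : Fin (n + 2) × Fin (n + 2)) : Fin (n + 2) × Fin (n + 2) :=
  if (a : ℕ) ≤ d.1 ↔ (a : ℕ) ≤ d.2 then (rk a d.1, rk a d.2) else (rk a d.2, rk a d.1)

theorem rot_inj {n : ℕ} (a : Fin (n + 2)) : Function.Injective (rot a) := by
  rintro ⟨x, y⟩ ⟨u, v⟩ h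
  have := x.2
  have := y.2
  have := u.2
  have := v.2
  have := a.2
  simp only [rot] at h
  have key : (x : ℕ) = u ∧ (y : ℕ) = v := by
    split_ifs at h <;> simp only [Prod.mk.injEq, Fin.ext_iff, rk_val] at h <;>
      split_ifs at h <;> omega
  rw [Prod.mk.injEq]
  exact ⟨Fin.ext key.1, Fin.ext key.2⟩

theorem rot_diag {n : ℕ} (a : Fin (n + 2)) (d : Fin (n + 2) × Fin (n + 2)) :
    IsDiag n (rot a d) ↔ IsDiag n d := by
  obtain ⟨x, y⟩ := d
  have := x.2
  have := y.2
  have := a.2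
  simp only [rot]
  split_ifs <;> simp only [isDiag_iff, rk_val] <;> split_ifs <;> omega

theorem rot_cross {n : ℕ} (a : Fin (n + 2)) (d e : Fin (n + 2) × Fin (n + 2))
    (hd : IsDiag n d) (he : IsDiag n e) :
    Crossing (rot a d) (rot a e) ↔ Crossing d e := by
  obtain ⟨x, y⟩ := d
  obtain ⟨u, v⟩ := e
  have := x.2
  have := y.2
  have := u.2
  have := v.2
  have := a.2
  rw [isDiag_iff] at hd he
  simp only [rot]
  split_ifs <;> simp only [Crossing, Fin.lt_def, rk_val] <;> split_ifs <;> omega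

noncomputable def rotE {n : ℕ} (a : Fin (n + 2)) : Equiv.Perm (Fin (n + 2) × Fin (n + 2)) :=
  Equiv.ofBijective (rot a) (Finite.injective_iff_bijective.1 (rot_inj a))

theorem map_tri {n : ℕ} (ρ : Equiv.Perm (Fin (n + 2) × Fin (n + 2)))
    (h1 : ∀ d, IsDiag n (ρ d) ↔ IsDiag n d)
    (h2 : ∀ d e, IsDiag n d → IsDiag n e → (Crossing (ρ d) (ρ e) ↔ Crossing d e))
    {T : Finset (Fin (n + 2) × Fin (n + 2))} (h : IsTriangulation n T) :
    IsTriangulation n (T.map ρ.toEmbedding) := by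
  refine ⟨?_, ?_, ?_⟩
  · intro d hd
    obtain ⟨d, hd1, rfl⟩ := Finset.mem_map.1 hd
    exact (h1 d).2 (h.1 d hd1)
  · intro d hd e he
    obtain ⟨d, hd1, rfl⟩ := Finset.mem_map.1 hd
    obtain ⟨e, he1, rfl⟩ := Finset.mem_map.1 he
    exact fun hc => h.2.1 d hd1 e he1 ((h2 d e (h.1 d hd1) (h.1 e he1)).1 hc)
  · intro e he hc
    obtain ⟨e, rfl⟩ := ρ.surjective e
    have he' := (h1 e).1 he
    refine Finset.mem_map.2 ⟨e, h.2.2 e he' fun d hd hcr => ?_, rfl⟩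
    exact hc (ρ d) (Finset.mem_map.2 ⟨d, hd, rfl⟩) ((h2 d e (h.1 d hd) he').2 hcr)

/-- The flip graph homomorphism induced by a symmetry. -/
def mapHom {n : ℕ} (ρ : Equiv.Perm (Fin (n + 2) × Fin (n + 2)))
    (h1 : ∀ d, IsDiag n (ρ d) ↔ IsDiag n d)
    (h2 : ∀ d e, IsDiag n d → IsDiag n e → (Crossing (ρ d) (ρ e) ↔ Crossing d e)) :
    flipGraph n →g flipGraph n where
  toFun T := ⟨T.1.map ρ.toEmbedding, map_tri ρ h1 h2 T.2⟩
  map_rel' := by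
    intro T T' h
    rw [flip_adj] at h ⊢
    have key : ∀ A B : Finset (Fin (n + 2) × Fin (n + 2)),
        (A.map ρ.toEmbedding \ B.map ρ.toEmbedding).card = (A \ B).card := by
      intro A B
      rw [← Finset.map_sdiff, Finset.card_map]
    simp only [key]
    exact h

/-- Non-leaving-face property for the type `A` associahedron (Sleator–Tarjan–Thurston):
if triangulations `T` and `T'` both contain an interior diagonal `f`, then every geodesic
from `T` to `T'` in the flip graph passes only through triangulations containing `f`. -/
theorem flip_geodesic_keeps_diagonal {n : ℕ} (hn : 3 ≤ n)
    (f : Fin (n + 2) × Fin (n + 2)) (hf : IsDiag n f)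
    (T T' : {T : Finset (Fin (n + 2) × Fin (n + 2)) // IsTriangulation n T})
    (hfT : f ∈ T.1) (hfT' : f ∈ T'.1)
    (p : (flipGraph n).Walk T T') (hp : p.length = (flipGraph n).dist T T') :
    ∀ X ∈ p.support, f ∈ X.1 := by
  have h1 : ∀ d, IsDiag n (rotE f.1 d) ↔ IsDiag n d := rot_diag f.1
  have h2 : ∀ d e, IsDiag n d → IsDiag n e →
    (Crossing (rotE f.1 d) (rotE f.1 e) ↔ Crossing d e) := rot_cross f.1
  have h1' : ∀ d, IsDiag n ((rotE f.1).symm d) ↔ IsDiag n d := by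
    intro d
    rw [← h1, Equiv.apply_symm_apply]
  have h2' : ∀ d e, IsDiag n d → IsDiag n e →
      (Crossing ((rotE f.1).symm d) ((rotE f.1).symm e) ↔ Crossing d e) := by
    intro d e hd he
    rw [← h2 _ _ ((h1' d).2 hd) ((h1' e).2 he), Equiv.apply_symm_apply, Equiv.apply_symm_apply]
  set φ := mapHom (rotE f.1) h1 h2 with hφ
  set ψ := mapHom (rotE f.1).symm h1' h2' with hψ
  have hψφ : ∀ X, ψ (φ X) = X := by
    intro X
    apply Subtype.ext
    show (X.1.map (rotE f.1).toEmbedding).map (rotE f.1).symm.toEmbedding = X.1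
    ext d
    simp
  have hmem : ∀ X, rotE f.1 f ∈ (φ X).1 ↔ f ∈ X.1 := by
    intro X
    show rotE f.1 f ∈ X.1.map (rotE f.1).toEmbedding ↔ f ∈ X.1
    simp
  obtain ⟨b, hb⟩ : ∃ b, rotE f.1 f = (0, b) := by
    refine ⟨rk f.1 f.2, ?_⟩
    show rot f.1 f = _
    have : (f.1 : ℕ) ≤ f.2 := by
      have := hf.2.1
      omega
    rw [rot, if_pos (by simp [this])]
    rw [Prod.mk.injEq]
    refine ⟨Fin.ext ?_, rfl⟩
    simp [rk_val]
  rw [hb] at hmem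
  have hd : IsDiag n (0, b) := by
    rw [← hb, h1]
    exact hf
  have hlen : (p.map φ).length = (flipGraph n).dist (φ T) (φ T') := by
    apply le_antisymm
    · obtain ⟨q, hq⟩ := (p.map φ).reachable.exists_walk_length_eq_dist
      have := SimpleGraph.dist_le ((q.map ψ).copy (hψφ T) (hψφ T'))
      simp only [SimpleGraph.Walk.length_copy, SimpleGraph.Walk.length_map] at this ⊢
      omega
    · exact SimpleGraph.dist_le _
  intro X hX
  rw [← hmem]
  apply keeps_zero hn b hd (φ T) (φ T') ((hmem T).2 hfT) ((hmem T').2 hfT') (p.map φ) hlen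
  rw [SimpleGraph.Walk.support_map]
  exact List.mem_map_of_mem hX
end

section
/- Let T and T' be triangulations of a convex (n+2)-gon, f an interior diagonal contained in T' but not in T, and suppose T contains a triangulation T'' with f ∈ T'' that is one flip away from T (i.e. T is adjacent to some T'' containing f in the flip graph). Then there exists a geodesic in the flip graph from T to T' whose first step is T → T''. -/
open scoped Classical

structure Tri (m : ℕ) (E : ℕ → ℕ → Prop) : Prop where
  lt : ∀ x y, E x y → x < y ∧ y ≤ m
  nc : ∀ x y p q, E x y → E p q → ¬ (x < p ∧ p < y ∧ y < q)
  mx : ∀ x y, x < y → y ≤ m →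
    (∀ p q, E p q → ¬ (x < p ∧ p < y ∧ y < q) ∧ ¬ (p < x ∧ x < q ∧ q < y)) → E x y

def Sub1 (E F : ℕ → ℕ → Prop) : Prop :=
  ∀ x y p q, E x y → ¬ F x y → E p q → ¬ F p q → x = p ∧ y = q

/-- apex on the inner side -/
theorem Tri.apex_in {m E} (h : Tri m E) {x y : ℕ} (hE : E x y) (hxy : x + 1 < y) :
    ∃ w, x < w ∧ w < y ∧ E x w ∧ E w y := by
  classical
  have hlt := h.lt _ _ hE
  have h1 : E x (x+1) := h.mx _ _ (by omega) (by omega) (fun p q _ => by omega)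
  let P := fun w => w < y ∧ E x w
  have hP : P (Nat.findGreatest P y) :=
    Nat.findGreatest_spec (P := P) (m := x+1) (by omega) ⟨hxy, h1⟩
  set w := Nat.findGreatest P y with hw
  have hmax : ∀ k, w < k → k < y → ¬ E x k := fun k hk hky hE' =>
    Nat.findGreatest_is_greatest (P := P) hk (by omega) ⟨hky, hE'⟩
  have hxw := h.lt _ _ hP.2
  refine ⟨w, hxw.1, hP.1, hP.2, h.mx _ _ hP.1 (by omega) fun p q hpq => ?_⟩
  have a1 := h.nc _ _ _ _ hE hpq
  have a2 := h.nc _ _ _ _ hpq hE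
  have a3 := h.nc _ _ _ _ hP.2 hpq
  have a4 := h.nc _ _ _ _ hpq hP.2
  refine ⟨by omega, ?_⟩
  intro hh
  have : x = p := by omega
  subst this
  exact hmax q (by omega) (by omega) hpq

/-- apex on the outer side, given edge not the root edge -/
theorem Tri.apex_out {m E} (h : Tri m E) {x y : ℕ} (hE : E x y) (hxy : ¬ (x = 0 ∧ y = m)) :
    (∃ w, w < x ∧ E w x ∧ E w y) ∨ (∃ w, y < w ∧ E x w ∧ E y w) := by
  classical
  have hlt := h.lt _ _ hE
  -- the shortest edge strictly above (x,y)
  have hex : ∃ k, ∃ p q, E p q ∧ p ≤ x ∧ y ≤ q ∧ ¬ (p = x ∧ q = y) ∧ q = p + k :=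
    ⟨m, 0, m, h.mx _ _ (by omega) (by omega) (fun p q hpq => by have := h.lt _ _ hpq; omega),
      by omega, by omega, by omega, by omega⟩
  obtain ⟨p, q, hpq, hpx, hyq, hne, hk⟩ := Nat.find_spec hex
  have hmin : ∀ p' q', E p' q' → p' ≤ x → y ≤ q' → ¬ (p' = x ∧ q' = y) → q - p ≤ q' - p' := by
    intro p' q' h1 h2 h3 h4
    have := Nat.find_min' hex ⟨p', q', h1, h2, h3, h4, (by omega : q' = p' + (q' - p'))⟩
    omega
  have hl := h.lt _ _ hpq
  obtain ⟨w, hw1, hw2, hw3, hw4⟩ := h.apex_in hpq (by omega)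
  have a1 := h.nc _ _ _ _ hE hw3
  have a2 := h.nc _ _ _ _ hw3 hE
  have a3 := h.nc _ _ _ _ hE hw4
  have a4 := h.nc _ _ _ _ hw4 hE
  have b1 := hmin p w hw3
  have b2 := hmin w q hw4
  have : (w = x ∧ q = y) ∨ (w = y ∧ p = x) := by omega
  rcases this with ⟨rfl, rfl⟩ | ⟨rfl, rfl⟩
  · exact Or.inl ⟨p, hw1, hw3, hpq⟩
  · exact Or.inr ⟨q, hw2, hpq, hw4⟩

def N0 (m b : ℕ) (E : ℕ → ℕ → Prop) (x y : ℕ) : Prop :=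
  x < y ∧ y ≤ m ∧ ((E x y ∧ ¬ (0 < x ∧ x < b ∧ b < y)) ∨ (x = 0 ∧ y = b) ∨
    (x = 0 ∧ ∃ z, y < b ∧ b < z ∧ E y z) ∨ (x = 0 ∧ ∃ z, 0 < z ∧ z < b ∧ b < y ∧ E z y))

theorem N0_tri {m b E} (h : Tri m E) (hb : 0 < b) (hbm : b ≤ m) : Tri m (N0 m b E) := by
  classical
  have hlt := h.lt
  have hnc := h.nc
  refine ⟨fun x y hh => ⟨hh.1, hh.2.1⟩, ?_, ?_⟩
  · rintro x y p q ⟨h1, h2, h3⟩ ⟨h4, h5, h6⟩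
    rcases h3 with ⟨h3, h3'⟩ | ⟨rfl, rfl⟩ | ⟨rfl, z, h3, h3', h3''⟩ | ⟨rfl, z, h3, h3', h3'', h3'''⟩ <;>
    rcases h6 with ⟨h6, h6'⟩ | ⟨rfl, rfl⟩ | ⟨rfl, z', h6, h6', h6''⟩ | ⟨rfl, z', h6, h6', h6'', h6'''⟩ <;>
    try omega
    · exact hnc _ _ _ _ h3 h6
    · have := hnc _ _ _ _ h3'' h6
      have := hnc _ _ _ _ h6 h3''
      omega
    · have := hnc _ _ _ _ h3''' h6
      have := hnc _ _ _ _ h6 h3'''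
      omega
  · intro x y hxy hym hmx
    have hNE : ∀ p q, E p q → ¬ (0 < p ∧ p < b ∧ b < q) → 
        ¬ (x < p ∧ p < y ∧ y < q) ∧ ¬ (p < x ∧ x < q ∧ q < y) := fun p q hpq hc =>
      hmx p q ⟨(hlt _ _ hpq).1, (hlt _ _ hpq).2, Or.inl ⟨hpq, hc⟩⟩
    have hf := hmx 0 b ⟨hb, hbm, Or.inr (Or.inl ⟨rfl, rfl⟩)⟩
    by_cases hE : E x y
    · exact ⟨hxy, hym, Or.inl ⟨hE, by omega⟩⟩
    have hA : ∀ u v, E u v → 0 < u → u < b → b < v → N0 m b E 0 u := fun u v h1 h2 h3 h4 =>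
      ⟨h2, by omega, Or.inr (Or.inr (Or.inl ⟨rfl, v, h3, h4, h1⟩))⟩
    have hB : ∀ u v, E u v → 0 < u → u < b → b < v → N0 m b E 0 v := fun u v h1 h2 h3 h4 =>
      ⟨by omega, (hlt _ _ h1).2, Or.inr (Or.inr (Or.inr ⟨rfl, u, h2, h3, h4, h1⟩))⟩
    obtain ⟨u, v, huv, hcr⟩ : ∃ u v, E u v ∧ ¬ (¬ (x < u ∧ u < y ∧ y < v) ∧ ¬ (u < x ∧ x < v ∧ v < y)) := by
      by_contra hcon
      exact hE (h.mx _ _ hxy hym (fun p q hpq => by by_contra h9; exact hcon ⟨p, q, hpq, h9⟩))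
    have hlu := hlt _ _ huv
    by_cases huvf : 0 < u ∧ u < b ∧ b < v
    swap
    · exact absurd (hNE u v huv huvf) hcr
    obtain ⟨c1, c2, c3⟩ := huvf
    have d1 := hmx _ _ (hA u v huv c1 c2 c3)
    have d2 := hmx _ _ (hB u v huv c1 c2 c3)
    have hx0 : x = 0 := by omega
    subst hx0
    rcases Nat.lt_trichotomy y b with hyb | hyb | hyb
    · -- y in A, u maximal below y, v minimal
      let P := fun u => 0 < u ∧ u < y ∧ ∃ v, b < v ∧ E u v
      have hP : P (Nat.findGreatest P y) :=
        Nat.findGreatest_spec (P := P) (m := u) (by omega) ⟨c1, by omega, v, c3, huv⟩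
      have hmax : ∀ k, Nat.findGreatest P y < k → k < y → ∀ v, b < v → ¬ E k v := fun k hk hky v hv hE' =>
        Nat.findGreatest_is_greatest (P := P) hk (by omega) ⟨by omega, hky, v, hv, hE'⟩
      generalize Nat.findGreatest P y = u' at hP hmax
      obtain ⟨e1, e2, hex⟩ := hP
      obtain ⟨e3, e4⟩ := Nat.find_spec hex
      have hmin : ∀ v', b < v' → E u' v' → Nat.find hex ≤ v' := fun v' h1 h2 => Nat.find_min' hex ⟨h1, h2⟩
      generalize Nat.find hex = v' at e3 e4 hmin
      have e5 := hlt _ _ e4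
      refine ⟨hxy, hym, Or.inr (Or.inr (Or.inl ⟨rfl, v', hyb, e3, h.mx _ _ (by omega) e5.2 ?_⟩))⟩
      intro p q hpq
      have g1 := hnc _ _ _ _ hpq e4
      have g2 := hnc _ _ _ _ e4 hpq
      have g3 := hlt _ _ hpq
      have g4 := hNE _ _ hpq
      refine ⟨by omega, ?_⟩
      intro hh
      by_cases hpu : p = u'
      · subst hpu
        have := hmin q (by omega) hpq
        omega
      · exact hmax p (by omega) (by omega) q (by omega) hpq
    · exact ⟨hxy, hym, Or.inr (Or.inl ⟨rfl, hyb⟩)⟩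
    · -- y in B, v minimal above y, u maximal
      have hex : ∃ v, y < v ∧ ∃ u, 0 < u ∧ u < b ∧ E u v := ⟨v, by omega, u, c1, c2, huv⟩
      obtain ⟨e1, hP⟩ := Nat.find_spec hex
      have hmin : ∀ v', y < v' → ∀ u, 0 < u → u < b → E u v' → Nat.find hex ≤ v' :=
        fun v' h1 u h2 h3 h4 => Nat.find_min' hex ⟨h1, u, h2, h3, h4⟩
      generalize Nat.find hex = v' at e1 hP hmin
      obtain ⟨u0, f1, f2, f3⟩ := hP
      let P := fun u => 0 < u ∧ u < b ∧ E u v'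
      have hP : P (Nat.findGreatest P b) :=
        Nat.findGreatest_spec (P := P) (m := u0) (by omega) ⟨f1, f2, f3⟩
      have hmax : ∀ k, Nat.findGreatest P b < k → k < b → ¬ E k v' := fun k hk hky hE' =>
        Nat.findGreatest_is_greatest (P := P) hk (by omega) ⟨by omega, hky, hE'⟩
      generalize Nat.findGreatest P b = u' at hP hmax
      obtain ⟨e2, e3, e4⟩ := hP
      have e5 := hlt _ _ e4
      refine ⟨hxy, hym, Or.inr (Or.inr (Or.inr ⟨rfl, u', e2, e3, hyb, h.mx _ _ (by omega) hym ?_⟩))⟩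
      intro p q hpq
      have g1 := hnc _ _ _ _ hpq e4
      have g2 := hnc _ _ _ _ e4 hpq
      have g3 := hlt _ _ hpq
      have g4 := hNE _ _ hpq
      refine ⟨?_, by omega⟩
      intro hh
      by_cases hqv : q = v'
      · subst hqv
        exact hmax p (by omega) (by omega) hpq
      · have := hmin q (by omega) p (by omega) (by omega) hpq
        omega

theorem N0_sub {m b E F} (h : Tri m E) (hF : Tri m F) (hb : 0 < b) (hbm : b ≤ m) (hs : Sub1 E F) :
    Sub1 (N0 m b E) (N0 m b F) := by
  -- each element of the difference comes from an element of E \ F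
  have key : ∀ x y, N0 m b E x y → ¬ N0 m b F x y → 
      (E x y ∧ ¬ F x y ∧ ¬ (0 < x ∧ x < b ∧ b < y)) ∨
      (x = 0 ∧ ∃ z, 0 < y ∧ y < b ∧ b < z ∧ E y z ∧ ¬ F y z) ∨
      (x = 0 ∧ ∃ z, 0 < z ∧ z < b ∧ b < y ∧ E z y ∧ ¬ F z y) := by
    rintro x y ⟨h1, h2, h3⟩ hn
    rcases h3 with ⟨h3, h3'⟩ | ⟨rfl, rfl⟩ | ⟨rfl, z, h3, h3', h3''⟩ | ⟨rfl, z, h3, h3', h3'', h3'''⟩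
    · exact Or.inl ⟨h3, fun hf => hn ⟨h1, h2, Or.inl ⟨hf, h3'⟩⟩, h3'⟩
    · exact absurd ⟨h1, h2, Or.inr (Or.inl ⟨rfl, rfl⟩)⟩ hn
    · exact Or.inr (Or.inl ⟨rfl, z, h1, h3, h3', h3'', fun hf =>
        hn ⟨h1, h2, Or.inr (Or.inr (Or.inl ⟨rfl, z, h3, h3', hf⟩))⟩⟩)
    · exact Or.inr (Or.inr ⟨rfl, z, h3, h3', h3'', h3''', fun hf =>
        hn ⟨h1, h2, Or.inr (Or.inr (Or.inr ⟨rfl, z, h3, h3', h3'', hf⟩))⟩⟩)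
  -- not both ends
  have two : ∀ x y, 0 < x → x < b → b < y → E x y → ¬ F x y → 
      ¬ N0 m b F 0 x → ¬ N0 m b F 0 y → False := by
    intro x y h1 h2 h3 h4 h5 h6 h7
    have hm := h.lt _ _ h4
    have inF : ∀ p q, E p q → ¬ (p = x ∧ q = y) → F p q := fun p q h8 h9 => by
      by_contra h10
      exact h9 (hs _ _ _ _ h8 h10 h4 h5)
    rcases h.apex_out h4 (by omega) with ⟨w, w1, w2, w3⟩ | ⟨w, w1, w2, w3⟩
    · rcases Nat.eq_zero_or_pos w with rfl | hw
      · exact h6 ⟨h1, by omega, Or.inl ⟨inF _ _ w2 (by omega), by omega⟩⟩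
      · exact h7 ⟨by omega, by omega, Or.inr (Or.inr (Or.inr
          ⟨rfl, w, hw, by omega, h3, inF _ _ w3 (by omega)⟩))⟩
    · exact h6 ⟨by omega, by omega, Or.inr (Or.inr (Or.inl
          ⟨rfl, w, h2, by omega, inF _ _ w2 (by omega)⟩))⟩
  intro x y p q h1 h2 h3 h4
  rcases key _ _ h1 h2 with ⟨a1, a2, a3⟩ | ⟨rfl, z, a1, a2, a3, a4, a5⟩ | ⟨rfl, z, a1, a2, a3, a4, a5⟩ <;>
  rcases key _ _ h3 h4 with ⟨b1, b2, b3⟩ | ⟨rfl, z', b1, b2, b3, b4, b5⟩ | ⟨rfl, z', b1, b2, b3, b4, b5⟩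
  · exact hs _ _ _ _ a1 a2 b1 b2
  · have := hs _ _ _ _ a1 a2 b4 b5; omega
  · have := hs _ _ _ _ a1 a2 b4 b5; omega
  · have := hs _ _ _ _ a4 a5 b1 b2; omega
  · have := hs _ _ _ _ a4 a5 b4 b5; omega
  · have := hs _ _ _ _ a4 a5 b4 b5
    obtain ⟨rfl, rfl⟩ := this
    exact (two _ _ a1 a2 a3 a4 a5 h2 h4).elim
  · have := hs _ _ _ _ a4 a5 b1 b2; omega
  · have := hs _ _ _ _ a4 a5 b4 b5
    obtain ⟨rfl, rfl⟩ := this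
    exact (two _ _ b1 b2 b3 b4 b5 h4 h2).elim
  · have := hs _ _ _ _ a4 a5 b4 b5; omega

/-- rotation by one -/
def Ro (m : ℕ) (E : ℕ → ℕ → Prop) (x y : ℕ) : Prop :=
  x < y ∧ y ≤ m ∧ ((y < m ∧ E (x+1) (y+1)) ∨ (y = m ∧ E 0 (x+1)))
def Ri (m : ℕ) (E : ℕ → ℕ → Prop) (x y : ℕ) : Prop :=
  x < y ∧ y ≤ m ∧ ((x = 0 ∧ E (y-1) m) ∨ (0 < x ∧ E (x-1) (y-1)))

theorem Ro_tri {m E} (h : Tri m E) : Tri m (Ro m E) := by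
  have hlt := h.lt
  refine ⟨fun x y hh => ⟨hh.1, hh.2.1⟩, ?_, ?_⟩
  · rintro x y p q ⟨h1, h2, h3⟩ ⟨h4, h5, h6⟩
    rcases h3 with ⟨h3, h3'⟩ | ⟨h3, h3'⟩ <;>
    rcases h6 with ⟨h6, h6'⟩ | ⟨h6, h6'⟩ <;>
    (have := h.nc _ _ _ _ h3' h6'
     have := h.nc _ _ _ _ h6' h3'
     omega)
  · intro x y hxy hym hmx
    refine ⟨hxy, hym, ?_⟩
    have main : ∀ p q, E p q → (0 < p ∧ ¬ (x < p-1 ∧ p-1 < y ∧ y < q-1) ∧ ¬ (p-1 < x ∧ x < q-1 ∧ q-1 < y))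
        ∨ (p = 0 ∧ ¬ (x < q-1 ∧ q-1 < y ∧ y < m) ∧ ¬ (q-1 < x ∧ x < m ∧ m < y)) := by
      intro p q hpq
      have := hlt _ _ hpq
      rcases Nat.eq_zero_or_pos p with rfl | hp
      · right
        refine ⟨rfl, ?_⟩
        by_cases hq : q - 1 < m
        · exact hmx (q-1) m ⟨by omega, by omega, Or.inr ⟨rfl, by rwa [Nat.sub_add_cancel (by omega)]⟩⟩
        · omega
      · left
        refine ⟨hp, hmx (p-1) (q-1) ⟨by omega, by omega, Or.inl ⟨by omega, ?_⟩⟩⟩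
        rwa [Nat.sub_add_cancel (by omega), Nat.sub_add_cancel (by omega)]
    rcases Nat.lt_or_ge y m with hy | hy
    · refine Or.inl ⟨hy, h.mx _ _ (by omega) (by omega) fun p q hpq => ?_⟩
      have := main _ _ hpq
      have := hlt _ _ hpq
      omega
    · refine Or.inr ⟨by omega, h.mx _ _ (by omega) (by omega) fun p q hpq => ?_⟩
      have := main _ _ hpq
      have := hlt _ _ hpq
      omega

theorem Ri_tri {m E} (h : Tri m E) : Tri m (Ri m E) := by
  have hlt := h.lt
  refine ⟨fun x y hh => ⟨hh.1, hh.2.1⟩, ?_, ?_⟩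
  · rintro x y p q ⟨h1, h2, h3⟩ ⟨h4, h5, h6⟩
    rcases h3 with ⟨h3, h3'⟩ | ⟨h3, h3'⟩ <;>
    rcases h6 with ⟨h6, h6'⟩ | ⟨h6, h6'⟩ <;>
    (have := h.nc _ _ _ _ h3' h6'
     have := h.nc _ _ _ _ h6' h3'
     omega)
  · intro x y hxy hym hmx
    refine ⟨hxy, hym, ?_⟩
    have main : ∀ p q, E p q → (q < m ∧ ¬ (x < p+1 ∧ p+1 < y ∧ y < q+1) ∧ ¬ (p+1 < x ∧ x < q+1 ∧ q+1 < y))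
        ∨ (q = m ∧ ¬ (0 < x ∧ x < p+1 ∧ p+1 < y)) := by
      intro p q hpq
      have := hlt _ _ hpq
      rcases Nat.lt_or_ge q m with hq | hq
      · exact Or.inl ⟨hq, hmx (p+1) (q+1) ⟨by omega, by omega, Or.inr ⟨by omega, hpq⟩⟩⟩
      · have : q = m := by omega
        subst this
        exact Or.inr ⟨rfl, (hmx 0 (p+1) ⟨by omega, by omega, Or.inl ⟨by omega, hpq⟩⟩).2⟩
    rcases Nat.eq_zero_or_pos x with hx | hx
    · refine Or.inl ⟨hx, h.mx _ _ (by omega) (by omega) fun p q hpq => ?_⟩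
      have := main _ _ hpq
      have := hlt _ _ hpq
      omega
    · refine Or.inr ⟨hx, h.mx _ _ (by omega) (by omega) fun p q hpq => ?_⟩
      have := main _ _ hpq
      have := hlt _ _ hpq
      omega

theorem Ro_sub {m E F} (hs : Sub1 E F) : Sub1 (Ro m E) (Ro m F) := by
  rintro x y p q ⟨a1, a2, a3⟩ a4 ⟨b1, b2, b3⟩ b4
  have a5 : ¬ ((y < m ∧ F (x+1) (y+1)) ∨ (y = m ∧ F 0 (x+1))) := fun h => a4 ⟨a1, a2, h⟩
  have b5 : ¬ ((q < m ∧ F (p+1) (q+1)) ∨ (q = m ∧ F 0 (p+1))) := fun h => b4 ⟨b1, b2, h⟩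
  rcases a3 with ⟨h3, h3'⟩ | ⟨h3, h3'⟩ <;>
  rcases b3 with ⟨h6, h6'⟩ | ⟨h6, h6'⟩ <;>
  (have := hs _ _ _ _ h3' (fun h => a5 (by simp [h3, h])) h6' (fun h => b5 (by simp [h6, h]))
   omega)

theorem Ri_sub {m E F} (hs : Sub1 E F) : Sub1 (Ri m E) (Ri m F) := by
  rintro x y p q ⟨a1, a2, a3⟩ a4 ⟨b1, b2, b3⟩ b4
  have a5 : ¬ ((x = 0 ∧ F (y-1) m) ∨ (0 < x ∧ F (x-1) (y-1))) := fun h => a4 ⟨a1, a2, h⟩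
  have b5 : ¬ ((p = 0 ∧ F (q-1) m) ∨ (0 < p ∧ F (p-1) (q-1))) := fun h => b4 ⟨b1, b2, h⟩
  rcases a3 with ⟨h3, h3'⟩ | ⟨h3, h3'⟩ <;>
  rcases b3 with ⟨h6, h6'⟩ | ⟨h6, h6'⟩ <;>
  (have := hs _ _ _ _ h3' (fun h => a5 (by simp [h3, h])) h6' (fun h => b5 (by simp [h6, h]))
   omega)

theorem exists_proj (m a : ℕ) : ∀ b, a < b → b ≤ m → ∃ P : (ℕ → ℕ → Prop) → (ℕ → ℕ → Prop),
    (∀ E, Tri m E → Tri m (P E) ∧ P E a b ∧ ∀ x y, E x y →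
      ¬ (x < a ∧ a < y ∧ y < b) → ¬ (a < x ∧ x < b ∧ b < y) → P E x y) ∧
    (∀ E F, Tri m E → Tri m F → Sub1 E F → Sub1 (P E) (P F)) := by
  induction a with
  | zero =>
    intro b hb hbm
    refine ⟨N0 m b, fun E h => ⟨N0_tri h hb hbm, ⟨hb, hbm, Or.inr (Or.inl ⟨rfl, rfl⟩)⟩, ?_⟩,
      fun E F h hF => N0_sub h hF hb hbm⟩
    intro x y hxy _ h2
    exact ⟨(h.lt _ _ hxy).1, (h.lt _ _ hxy).2, Or.inl ⟨hxy, h2⟩⟩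
  | succ a ih =>
    intro b hb hbm
    obtain ⟨P, hP, hS⟩ := ih (b-1) (by omega) (by omega)
    refine ⟨fun E => Ri m (P (Ro m E)), fun E h => ?_, fun E F h hF hs =>
      Ri_sub (hS _ _ (Ro_tri h) (Ro_tri hF) (Ro_sub hs))⟩
    obtain ⟨h1, h2, h3⟩ := hP _ (Ro_tri h)
    refine ⟨Ri_tri h1, ⟨hb, hbm, Or.inr ⟨by omega, h2⟩⟩, ?_⟩
    intro x y hxy c1 c2
    have hl := h.lt _ _ hxy
    refine ⟨hl.1, hl.2, ?_⟩
    rcases Nat.eq_zero_or_pos x with rfl | hx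
    · by_cases hy : y - 1 < m
      · refine Or.inl ⟨rfl, h3 _ _ ⟨by omega, le_rfl, Or.inr ⟨rfl, ?_⟩⟩ (by omega) (by omega)⟩
        rwa [Nat.sub_add_cancel (by omega)]
      · omega
    · refine Or.inr ⟨hx, h3 _ _ ⟨by omega, by omega, Or.inl ⟨by omega, ?_⟩⟩ (by omega) (by omega)⟩
      rwa [Nat.sub_add_cancel (by omega), Nat.sub_add_cancel (by omega)]

/-- increase the degree at 0 by a flip -/
theorem exists_flip {m E} (h : Tri m E) {b : ℕ} (hb : 0 < b) (hbm : b ≤ m) (hE : ¬ E 0 b) :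
    ∃ F, Tri m F ∧ Sub1 E F ∧ Sub1 F E ∧ (∀ x, E 0 x → F 0 x) ∧ ∃ w, F 0 w ∧ ¬ E 0 w := by
  classical
  have hlt := h.lt
  have h01 : E 0 1 := h.mx _ _ (by omega) (by omega) (fun p q hpq => by omega)
  have h0m : E 0 m := h.mx _ _ (by omega) (by omega) (fun p q hpq => by have := h.lt _ _ hpq; omega)
  let P := fun u => E 0 u
  have hP : P (Nat.findGreatest P b) :=
      Nat.findGreatest_spec (P := P) (m := 1) (by omega) h01
  have hub : Nat.findGreatest P b ≤ b := Nat.findGreatest_le b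
  have hmax : ∀ k, Nat.findGreatest P b < k → k ≤ b → ¬ E 0 k := fun k hk hky hE' =>
    Nat.findGreatest_is_greatest (P := P) hk (by omega) hE'
  generalize Nat.findGreatest P b = u at hP hmax hub
  change E 0 u at hP
  have hub' : u ≠ b := by rintro rfl; exact hE hP
  have hex : ∃ v, u < v ∧ E 0 v := ⟨m, by omega, h0m⟩
  obtain ⟨e1, e2⟩ := Nat.find_spec hex
  have hmin : ∀ v', u < v' → E 0 v' → Nat.find hex ≤ v' := fun v' h1 h2 => Nat.find_min' hex ⟨h1, h2⟩
  generalize Nat.find hex = v at e1 e2 hmin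
  have hu0 := hlt _ _ hP
  have hv0 := hlt _ _ e2
  have hbv : b < v := by
    by_contra hcon
    exact hmax v e1 (by omega) e2
  have huv : E u v := by
    refine h.mx _ _ e1 hv0.2 fun p q hpq => ?_
    have g1 := h.nc _ _ _ _ hpq e2
    have g2 := h.nc _ _ _ _ e2 hpq
    have g3 := h.nc _ _ _ _ hpq hP
    have g4 := h.nc _ _ _ _ hP hpq
    refine ⟨by omega, ?_⟩
    intro hh
    have : p = 0 := by omega
    subst this
    have := hmin q (by omega) hpq
    omega
  obtain ⟨w, w1, w2, w3, w4⟩ := h.apex_in huv (by omega)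
  have hw0 : ¬ E 0 w := fun hh => by have := hmin w w1 hh; omega
  refine ⟨fun x y => (E x y ∧ ¬ (x = u ∧ y = v)) ∨ (x = 0 ∧ y = w), ⟨?_, ?_, ?_⟩, ?_, ?_, ?_, ?_⟩
  · rintro x y (hh | ⟨rfl, rfl⟩)
    · exact hlt _ _ hh.1
    · omega
  · have hone : ∀ p q, E p q → ¬ (p = u ∧ q = v) → ¬ (0 < p ∧ p < w ∧ w < q) := by
      intro p q hpq hne
      have := h.nc _ _ _ _ hpq hP
      have := h.nc _ _ _ _ hP hpq
      have := h.nc _ _ _ _ hpq e2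
      have := h.nc _ _ _ _ e2 hpq
      have := h.nc _ _ _ _ hpq w3
      have := h.nc _ _ _ _ w3 hpq
      have := h.nc _ _ _ _ hpq w4
      have := h.nc _ _ _ _ w4 hpq
      omega
    rintro x y p q (⟨h1, h2⟩ | ⟨rfl, rfl⟩) (⟨h3, h4⟩ | ⟨rfl, rfl⟩)
    · exact h.nc _ _ _ _ h1 h3
    · omega
    · exact hone _ _ h3 h4
    · omega
  · intro x y hxy hym hmx
    by_cases hxw : x = 0 ∧ y = w
    · exact Or.inr hxw
    have k0 := hmx 0 w (Or.inr ⟨rfl, rfl⟩)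
    have k1 := hmx _ _ (Or.inl ⟨hP, by omega⟩)
    have k2 := hmx _ _ (Or.inl ⟨e2, by omega⟩)
    have k3 := hmx _ _ (Or.inl ⟨w3, by omega⟩)
    have k4 := hmx _ _ (Or.inl ⟨w4, by omega⟩)
    refine Or.inl ⟨h.mx _ _ hxy hym fun p q hpq => ?_, by omega⟩
    by_cases hne : p = u ∧ q = v
    · obtain ⟨rfl, rfl⟩ := hne
      omega
    · exact hmx _ _ (Or.inl ⟨hpq, hne⟩)
  · intro x y p q h1 h2 h3 h4
    have a : x = u ∧ y = v := by by_contra hh; exact h2 (Or.inl ⟨h1, hh⟩)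
    have b : p = u ∧ q = v := by by_contra hh; exact h4 (Or.inl ⟨h3, hh⟩)
    omega
  · intro x y p q h1 h2 h3 h4
    rcases h1 with h1 | h1
    · exact absurd h1.1 h2
    rcases h3 with h3 | h3
    · exact absurd h3.1 h4
    omega
  · intro x hx
    exact Or.inl ⟨hx, by omega⟩
  · exact ⟨w, Or.inr ⟨rfl, rfl⟩, hw0⟩

def toE (n : ℕ) (T : Finset (Fin (n + 2) × Fin (n + 2))) (x y : ℕ) : Prop :=
  ∃ (hx : x < n + 2) (hy : y < n + 2), x < y ∧
    (IsDiag n (⟨x, hx⟩, ⟨y, hy⟩) → ((⟨x, hx⟩, ⟨y, hy⟩) : Fin (n + 2) × Fin (n + 2)) ∈ T)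

noncomputable def toT (n : ℕ) (E : ℕ → ℕ → Prop) : Finset (Fin (n + 2) × Fin (n + 2)) :=
  Finset.univ.filter (fun d => IsDiag n d ∧ E d.1 d.2)

theorem mem_iff_toE {n T} {d : Fin (n + 2) × Fin (n + 2)} (hd : IsDiag n d) :
    d ∈ T ↔ toE n T d.1 d.2 :=
  ⟨fun h => ⟨d.1.2, d.2.2, hd.1, fun _ => h⟩, fun ⟨_, _, _, h⟩ => h hd⟩

theorem toE_tri {n T} (h : IsTriangulation n T) : Tri (n + 1) (toE n T) := by
  obtain ⟨h1, h2, h3⟩ := h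
  refine ⟨?_, ?_, ?_⟩
  · rintro x y ⟨hx, hy, hxy, _⟩
    omega
  · rintro x y p q ⟨hx, hy, hxy, h⟩ ⟨hp, hq, hpq, h'⟩ hc
    have a := h (by simp only [IsDiag, Fin.lt_def]; omega)
    have b := h' (by simp only [IsDiag, Fin.lt_def]; omega)
    exact h2 _ a _ b (Or.inl (by simp only [Fin.lt_def]; exact hc))
  · intro x y hxy hy hm
    refine ⟨by omega, by omega, hxy, fun hd => h3 _ hd ?_⟩
    intro d hdT hc
    have := hm d.1 d.2 ((mem_iff_toE (h1 d hdT)).1 hdT)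
    simp only [Crossing, Fin.lt_def] at hc
    omega

theorem toT_tri {n E} (h : Tri (n + 1) E) : IsTriangulation n (toT n E) := by
  refine ⟨?_, ?_, ?_⟩
  · intro d hd
    exact (Finset.mem_filter.1 hd).2.1
  · intro d hd e he hc
    have a := (Finset.mem_filter.1 hd).2.2
    have b := (Finset.mem_filter.1 he).2.2
    have := h.nc _ _ _ _ a b
    have := h.nc _ _ _ _ b a
    simp only [Crossing, Fin.lt_def] at hc
    omega
  · intro e he hm
    refine Finset.mem_filter.2 ⟨Finset.mem_univ _, he, h.mx _ _ he.1 (by omega) ?_⟩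
    intro p q hpq
    have hl := h.lt _ _ hpq
    have hb := e.1.2
    have hb2 := e.2.2
    by_cases hd : IsDiag n ((⟨p, by omega⟩, ⟨q, by omega⟩) : Fin (n + 2) × Fin (n + 2))
    · have := hm _ (Finset.mem_filter.2 ⟨Finset.mem_univ _, hd, hpq⟩)
      simp only [Crossing, Fin.lt_def] at this
      omega
    · simp only [IsDiag, Fin.lt_def] at hd
      omega

theorem toE_toT {n E} (h : Tri (n + 1) E) (x y : ℕ) : toE n (toT n E) x y ↔ E x y := by
  constructor
  · rintro ⟨hx, hy, hxy, hh⟩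
    by_cases hd : IsDiag n ((⟨x, hx⟩, ⟨y, hy⟩) : Fin (n + 2) × Fin (n + 2))
    · exact (Finset.mem_filter.1 (hh hd)).2.2
    · simp only [IsDiag, Fin.lt_def] at hd
      refine h.mx _ _ hxy (by omega) fun p q hpq => ?_
      have := h.lt _ _ hpq
      omega
  · intro hE
    have := h.lt _ _ hE
    exact ⟨by omega, by omega, this.1, fun hd => Finset.mem_filter.2 ⟨Finset.mem_univ _, hd, hE⟩⟩

theorem tri_ext {n} {T U : {T : Finset (Fin (n + 2) × Fin (n + 2)) // IsTriangulation n T}}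
    (h : ∀ x y, toE n T.1 x y → toE n U.1 x y) : T = U := by
  apply Subtype.ext
  have hs : T.1 ⊆ U.1 := fun d hd => by
    have hD := T.2.1 d hd
    exact (mem_iff_toE hD).2 (h _ _ ((mem_iff_toE hD).1 hd))
  refine Finset.Subset.antisymm hs fun e he => T.2.2.2 e (U.2.1 e he) fun d hd => 
    U.2.2.1 d (hs hd) e he

theorem sub_of_card {n} {T U : Finset (Fin (n + 2) × Fin (n + 2))}
    (h : (T \ U).card = 1) : Sub1 (toE n T) (toE n U) := by
  obtain ⟨d, hd⟩ := Finset.card_eq_one.1 h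
  have key : ∀ x y, toE n T x y → ¬ toE n U x y → x = d.1 ∧ y = d.2 := by
    rintro x y ⟨hx, hy, hxy, hh⟩ hn
    by_cases hD : IsDiag n ((⟨x, hx⟩, ⟨y, hy⟩) : Fin (n + 2) × Fin (n + 2))
    · have : ((⟨x, hx⟩, ⟨y, hy⟩) : Fin (n + 2) × Fin (n + 2)) ∈ T \ U :=
        Finset.mem_sdiff.2 ⟨hh hD, fun hu => hn ⟨hx, hy, hxy, fun _ => hu⟩⟩
      rw [hd, Finset.mem_singleton] at this
      subst this
      exact ⟨rfl, rfl⟩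
    · exact absurd ⟨hx, hy, hxy, fun h => absurd h hD⟩ hn
  intro x y p q h1 h2 h3 h4
  have := key _ _ h1 h2
  have := key _ _ h3 h4
  omega

theorem sub_of_adj {n} {T U : {T : Finset (Fin (n + 2) × Fin (n + 2)) // IsTriangulation n T}}
    (h : (flipGraph n).Adj T U) : Sub1 (toE n T.1) (toE n U.1) := by
  rw [flipGraph, SimpleGraph.fromRel_adj] at h
  rcases h.2 with h | h
  · exact sub_of_card h.1
  · exact sub_of_card h.2

theorem card_of_sub {n} {T U : {T : Finset (Fin (n + 2) × Fin (n + 2)) // IsTriangulation n T}}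
    (hne : T ≠ U) (h : Sub1 (toE n T.1) (toE n U.1)) : (T.1 \ U.1).card = 1 := by
  apply le_antisymm
  · rw [Finset.card_le_one]
    intro d hd e he
    rw [Finset.mem_sdiff] at hd he
    have hD := T.2.1 d hd.1
    have hE := T.2.1 e he.1
    rw [mem_iff_toE hD, mem_iff_toE hD] at hd
    rw [mem_iff_toE hE, mem_iff_toE hE] at he
    have := h _ _ _ _ hd.1 hd.2 he.1 he.2
    exact Prod.ext (Fin.ext this.1) (Fin.ext this.2)
  · by_contra hcon
    have h0 : (T.1 \ U.1).card = 0 := by omega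
    rw [Finset.card_eq_zero, Finset.sdiff_eq_empty_iff_subset] at h0
    exact hne (tri_ext fun x y ⟨hx, hy, hxy, hh⟩ => ⟨hx, hy, hxy, fun hd => h0 (hh hd)⟩)

theorem adj_of_sub {n} {T U : {T : Finset (Fin (n + 2) × Fin (n + 2)) // IsTriangulation n T}}
    (hne : T ≠ U) (h : Sub1 (toE n T.1) (toE n U.1)) (h' : Sub1 (toE n U.1) (toE n T.1)) :
    (flipGraph n).Adj T U := by
  rw [flipGraph, SimpleGraph.fromRel_adj]
  exact ⟨hne, Or.inl ⟨card_of_sub hne h, card_of_sub hne.symm h'⟩⟩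

theorem Sub1.congr {E F E' F' : ℕ → ℕ → Prop} (h : Sub1 E F) (hE : ∀ x y, E' x y ↔ E x y)
    (hF : ∀ x y, F' x y ↔ F x y) : Sub1 E' F' := by
  intro x y p q h1 h2 h3 h4
  rw [hE] at h1 h3
  rw [hF] at h2 h4
  exact h _ _ _ _ h1 h2 h3 h4

theorem reach_fan {n} (k : ℕ) : ∀ T : {T : Finset (Fin (n + 2) × Fin (n + 2)) // IsTriangulation n T},
    ((Finset.range (n + 2)).filter (fun x => ¬ toE n T.1 0 x)).card ≤ k →
    ∃ U, (flipGraph n).Reachable T U ∧ ∀ x, 0 < x → x ≤ n + 1 → toE n U.1 0 x := by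
  induction k with
  | zero =>
    intro T hT
    refine ⟨T, SimpleGraph.Reachable.refl _, fun x h0 hx => ?_⟩
    by_contra hcon
    have h0 := Finset.card_eq_zero.1 (Nat.le_zero.1 hT)
    have : x ∈ (Finset.range (n + 2)).filter (fun x => ¬ toE n T.1 0 x) :=
      Finset.mem_filter.2 ⟨Finset.mem_range.2 (by omega), hcon⟩
    rw [h0] at this
    simp at this
  | succ k ih =>
    intro T hT
    by_cases hall : ∀ x, 0 < x → x ≤ n + 1 → toE n T.1 0 x
    · exact ⟨T, SimpleGraph.Reachable.refl _, hall⟩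
    push Not at hall
    obtain ⟨b, hb, hbm, hE⟩ := hall
    obtain ⟨F, hF, s1, s2, hsub, w, hw, hw'⟩ := exists_flip (toE_tri T.2) hb hbm hE
    have hFF := toE_toT hF
    let U : {T : Finset (Fin (n + 2) × Fin (n + 2)) // IsTriangulation n T} := ⟨toT n F, toT_tri hF⟩
    have hadj : (flipGraph n).Adj T U := by
      refine adj_of_sub ?_ (s1.congr (fun _ _ => Iff.rfl) hFF) (s2.congr hFF (fun _ _ => Iff.rfl))
      intro hTU
      apply hw'
      rw [hTU]
      exact (hFF _ _).2 hw
    have hlt : ((Finset.range (n + 2)).filter (fun x => ¬ toE n U.1 0 x)).card <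
        ((Finset.range (n + 2)).filter (fun x => ¬ toE n T.1 0 x)).card := by
      apply Finset.card_lt_card
      rw [Finset.ssubset_iff_of_subset]
      · refine ⟨w, Finset.mem_filter.2 ⟨Finset.mem_range.2 ?_, hw'⟩, ?_⟩
        · have := hF.lt _ _ hw
          omega
        · intro hh
          exact (Finset.mem_filter.1 hh).2 ((hFF _ _).2 hw)
      · intro x hx
        rw [Finset.mem_filter] at hx ⊢
        exact ⟨hx.1, fun hh => hx.2 ((hFF _ _).2 (hsub _ hh))⟩
    obtain ⟨W, hW1, hW2⟩ := ih U (by omega)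
    exact ⟨W, hadj.reachable.trans hW1, hW2⟩

theorem flip_reachable {n} (T U : {T : Finset (Fin (n + 2) × Fin (n + 2)) // IsTriangulation n T}) :
    (flipGraph n).Reachable T U := by
  obtain ⟨A, hA, hA'⟩ := reach_fan _ T le_rfl
  obtain ⟨B, hB, hB'⟩ := reach_fan _ U le_rfl
  have : A = B := by
    apply tri_ext
    intro x y hxy
    have h := toE_tri A.2
    have hl := h.lt _ _ hxy
    rcases Nat.eq_zero_or_pos x with rfl | hx
    · exact hB' _ (by omega) (by omega)
    · refine (toE_tri B.2).mx _ _ hl.1 hl.2 fun p q hpq => ?_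
      have := h.nc _ _ _ _ (hA' (x+1) (by omega) (by omega)) hxy
      omega
  subst this
  exact hA.trans hB.symm

theorem flip_geodesic_first_step {n : ℕ} (hn : 3 ≤ n)
    (f : Fin (n + 2) × Fin (n + 2)) (hf : IsDiag n f)
    (T T' T'' : {T : Finset (Fin (n + 2) × Fin (n + 2)) // IsTriangulation n T})
    (hfT : f ∉ T.1) (hfT' : f ∈ T'.1) (hfT'' : f ∈ T''.1)
    (hadj : (flipGraph n).Adj T T'') :
    ∃ q : (flipGraph n).Walk T'' T',
      (SimpleGraph.Walk.cons hadj q).length = (flipGraph n).dist T T' := by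
  have hconn : (flipGraph n).Connected := by
    haveI : Nonempty {T : Finset (Fin (n + 2) × Fin (n + 2)) // IsTriangulation n T} := ⟨T⟩
    exact ⟨fun A B => flip_reachable A B⟩
  obtain ⟨P, hP, hS⟩ := exists_proj (n + 1) f.1 f.2 hf.1 (by omega)
  let N : {T : Finset (Fin (n + 2) × Fin (n + 2)) // IsTriangulation n T} →
      {T : Finset (Fin (n + 2) × Fin (n + 2)) // IsTriangulation n T} :=
    fun A => ⟨toT n (P (toE n A.1)), toT_tri (hP _ (toE_tri A.2)).1⟩
  have hNE : ∀ A x y, toE n (N A).1 x y ↔ P (toE n A.1) x y := fun A =>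
    toE_toT (hP _ (toE_tri A.2)).1
  have hNadj : ∀ A B, (flipGraph n).Adj A B → (flipGraph n).dist (N A) (N B) ≤ 1 := by
    intro A B hAB
    by_cases hne : N A = N B
    · rw [hne, SimpleGraph.dist_self]; omega
    · refine le_of_eq (SimpleGraph.dist_eq_one_iff_adj.2 (adj_of_sub hne ?_ ?_))
      · exact (hS _ _ (toE_tri A.2) (toE_tri B.2) (sub_of_adj hAB)).congr (hNE A) (hNE B)
      · exact (hS _ _ (toE_tri B.2) (toE_tri A.2) (sub_of_adj hAB.symm)).congr (hNE B) (hNE A)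
  have hNflip : ∀ A B, (flipGraph n).Adj A B → f ∉ A.1 → f ∈ B.1 → N A = B := by
    intro A B hAB hA hB
    symm
    apply tri_ext
    intro x y hxy
    rw [hNE]
    have hEB := toE_tri B.2
    have hfB := (mem_iff_toE hf).1 hB
    have hfA : ¬ toE n A.1 f.1 f.2 := fun h => hA ((mem_iff_toE hf).2 h)
    by_cases hxA : toE n A.1 x y
    · exact (hP _ (toE_tri A.2)).2.2 x y hxA (hEB.nc _ _ _ _ hxy hfB) (hEB.nc _ _ _ _ hfB hxy)
    · obtain ⟨rfl, rfl⟩ := sub_of_adj hAB.symm _ _ _ _ hxy hxA hfB hfA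
      exact (hP _ (toE_tri A.2)).2.1
  have hwalk : ∀ A B (p : (flipGraph n).Walk A B), f ∉ A.1 → f ∈ B.1 →
      (flipGraph n).dist (N A) B + 1 ≤ p.length := by
    intro A B p
    induction p with
    | nil => intro h1 h2; exact absurd h2 h1
    | @cons A U B hAU p ih =>
      intro h1 h2
      rw [SimpleGraph.Walk.length_cons]
      by_cases hU : f ∈ U.1
      · rw [hNflip A U hAU h1 hU]
        have := SimpleGraph.dist_le p
        omega
      · have a := ih hU h2
        have b := hNadj A U hAU
        have c := hconn.dist_triangle (u := N A) (v := N U) (w := B)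
        omega
  obtain ⟨p, hp⟩ := hconn.exists_walk_length_eq_dist T T'
  obtain ⟨q, hq⟩ := hconn.exists_walk_length_eq_dist T'' T'
  have h1 := hwalk T T' p hfT hfT'
  rw [hNflip T T'' hadj hfT hfT''] at h1
  have h2 := SimpleGraph.dist_le (SimpleGraph.Walk.cons hadj q)
  refine ⟨q, le_antisymm ?_ h2⟩
  rw [SimpleGraph.Walk.length_cons]
  omega
end
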